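/- Let 0 < a < 1 and let ψ: ℝ → ℝ be an integrable function vanishing outside [-1,1]. Then ∫_{1/2}^{∞} (F(1,u) - F(a,u)) · ψ̂'(u + 1/2) du = ∫_{-1}^{1} x ψ(x) e^{x/2} (K(1,x) - K(a,x)) dx (both integrals being absolutely convergent), where ψ̂'(u) = ∫_ℝ x ψ(x) e^{ux} dx. -/

import Mathlib

open MeasureTheory

/-- `E x = ∫_{1}^{∞} e^{-tx} t^{-2} dt`. -/
noncomputable def E (x : ℝ) : ℝ := ∫ t in Set.Ioi (1:ℝ), Real.exp (-(t*x)) / t^2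

/-- `c = 4π·sin((π-1)/2)`. -/
noncomputable def c : ℝ := 4 * Real.pi * Real.sin ((Real.pi - 1)/2)

/-- `F(a,u) = (1/(c u²))·( e^{-2u/a} + u e^{-u} E(((2-a)/a)u) - u e^{u} E(((2+a)/a)u) )`. -/
noncomputable def F (a u : ℝ) : ℝ :=
  (1/(c*u^2)) * (Real.exp (-2*u/a) + u * Real.exp (-u) * E (((2-a)/a)*u)
    - u * Real.exp u * E (((2+a)/a)*u))

/-- `K(a,x)` as in the paper. -/
noncomputable def K (a x : ℝ) : ℝ :=
  (2/c) * (E ((1/2)*(2/a - x))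
    + (1/(x-1)) * (E ((1/2)*(2/a - x)) - Real.exp ((x-1)/2) * E ((1/2)*(2/a - 1)))
    - (1/(x+1)) * (E ((1/2)*(2/a - x)) - Real.exp ((x+1)/2) * E ((1/2)*(2/a + 1))))

/-- `ψ̂'(u) = ∫_ℝ x ψ(x) e^{ux} dx`, the derivative of the Laplace transform of `ψ`. -/
noncomputable def laplaceDeriv (ψ : ℝ → ℝ) (u : ℝ) : ℝ := ∫ x : ℝ, x * ψ x * Real.exp (u * x)

open Filter Topology

theorem integrableOn_exp_neg_mul_div_sq {b p : ℝ} (hb : 0 ≤ b) (hp : 0 < p) :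
    IntegrableOn (fun s : ℝ => Real.exp (-(s * b)) / s ^ 2) (Set.Ioi p) := by
  have h := integrableOn_Ioi_rpow_of_lt (a := -2) (by norm_num) hp
  refine h.mono' (Measurable.aestronglyMeasurable (by fun_prop)) ?_
  filter_upwards [ae_restrict_mem measurableSet_Ioi] with s hs
  have hs0 : 0 < s := hp.trans hs
  rw [Real.norm_of_nonneg (by positivity), Real.rpow_neg hs0.le, div_eq_mul_inv]
  norm_cast
  have : Real.exp (-(s * b)) ≤ 1 := Real.exp_le_one_iff.2 (by nlinarith)
  exact mul_le_of_le_one_left (by positivity) this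

theorem E_mul_div {b u : ℝ} (hu : 0 < u) :
    E (b * u) / u = ∫ s in Set.Ioi u, Real.exp (-(s * b)) / s ^ 2 := by
  have h := integral_comp_mul_left_Ioi (fun s : ℝ => Real.exp (-(s * b)) / s ^ 2) 1 hu
  rw [mul_one, smul_eq_mul] at h
  have h2 : E (b * u) = u ^ 2 * ∫ t in Set.Ioi (1 : ℝ), Real.exp (-(u * t * b)) / (u * t) ^ 2 := by
    rw [E, ← integral_const_mul]
    refine setIntegral_congr_fun measurableSet_Ioi fun t ht => ?_
    have ht0 : (0 : ℝ) < t := zero_lt_one.trans ht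
    have : t * (b * u) = u * t * b := by ring
    simp only [this]
    field_simp
  rw [h2, h, ← mul_assoc, mul_div_right_comm]
  rw [show u ^ 2 * u⁻¹ / u = 1 by field_simp, one_mul]

theorem E_nonneg (y : ℝ) : 0 ≤ E y :=
  setIntegral_nonneg measurableSet_Ioi fun t _ => by positivity

theorem E_le_exp_neg {y : ℝ} (hy : 0 ≤ y) : E y ≤ Real.exp (-y) := by
  have h1 : IntegrableOn (fun t : ℝ => Real.exp (-y) * t ^ (-2 : ℝ)) (Set.Ioi 1) :=
    (integrableOn_Ioi_rpow_of_lt (by norm_num) one_pos).const_mul _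
  calc E y ≤ ∫ t in Set.Ioi (1 : ℝ), Real.exp (-y) * t ^ (-2 : ℝ) := by
        refine setIntegral_mono_on (integrableOn_exp_neg_mul_div_sq hy one_pos) h1
          measurableSet_Ioi fun t ht => ?_
        have ht1 : (1 : ℝ) < t := ht
        rw [Real.rpow_neg (by linarith), div_eq_mul_inv]
        norm_cast
        gcongr
        nlinarith
    _ = Real.exp (-y) := by
        rw [integral_const_mul, integral_Ioi_rpow_of_lt (by norm_num) one_pos]
        norm_num

theorem measurable_E : Measurable E := by
  have : StronglyMeasurable (Function.uncurry fun x t : ℝ => Real.exp (-(t * x)) / t ^ 2) :=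
    Measurable.stronglyMeasurable (by unfold Function.uncurry; fun_prop)
  exact this.integral_prod_right.measurable

theorem measurable_F (a : ℝ) : Measurable (F a) := by
  have := measurable_E
  unfold F
  fun_prop

theorem hasDerivAt_E_mul_div {b u : ℝ} (hb : 0 ≤ b) (hu : 0 < u) :
    HasDerivAt (fun v => E (b * v) / v) (-(Real.exp (-(u * b)) / u ^ 2)) u := by
  have hI : ∀ {v : ℝ}, 0 < v →
      IntegrableOn (fun s : ℝ => Real.exp (-(s * b)) / s ^ 2) (Set.Ioi v) :=
    fun hv => integrableOn_exp_neg_mul_div_sq hb hv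
  have hint : IntervalIntegrable (fun s : ℝ => Real.exp (-(s * b)) / s ^ 2) volume 1 u := by
    rw [intervalIntegrable_iff]
    exact (hI (lt_min one_pos hu)).mono_set Set.Ioc_subset_Ioi_self
  have h := intervalIntegral.integral_hasDerivAt_right hint
    (Measurable.stronglyMeasurable (by fun_prop)).stronglyMeasurableAtFilter
    (ContinuousAt.div (by fun_prop) (by fun_prop) (by positivity))
  refine (h.const_sub (∫ s in Set.Ioi (1 : ℝ), Real.exp (-(s * b)) / s ^ 2)).congr_of_eventuallyEq ?_
  filter_upwards [lt_mem_nhds hu] with v hv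
  rw [E_mul_div hv, ← intervalIntegral.integral_interval_add_Ioi (hI one_pos) (hI hv)]
  ring

theorem integral_Ioi_half_exp_neg_mul_div_sq (b : ℝ) :
    ∫ u in Set.Ioi (1 / 2 : ℝ), Real.exp (-(u * b)) / u ^ 2 = 2 * E (1 / 2 * b) := by
  rw [← E_mul_div (by norm_num : (0 : ℝ) < 1 / 2), mul_comm b]
  ring

theorem integrableOn_exp_mul_E_mul_div {b y : ℝ} (hb : 0 ≤ b) (hyb : y < b) :
    IntegrableOn (fun u => Real.exp (u * y) * (E (b * u) / u)) (Set.Ioi (1 / 2)) := by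
  have hE := measurable_E
  refine ((integrableOn_exp_mul_Ioi (sub_neg.2 hyb) (1 / 2)).const_mul 2).mono' (by fun_prop) ?_
  filter_upwards [ae_restrict_mem measurableSet_Ioi] with u hu
  have hu' : 1 / 2 < u := hu
  have hu0 : 0 < u := by linarith
  rw [Real.norm_of_nonneg (mul_nonneg (Real.exp_pos _).le (div_nonneg (E_nonneg _) hu0.le)),
    sub_mul, sub_eq_add_neg, Real.exp_add, mul_comm u y, ← mul_assoc, mul_comm 2, mul_assoc]
  gcongr
  rw [div_le_iff₀ hu0]
  nlinarith [E_le_exp_neg (mul_nonneg hb hu0.le), Real.exp_pos (-(b * u))]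

theorem integral_exp_mul_E_mul_div {b y : ℝ} (hb : 0 ≤ b) (hyb : y < b) (hy : y ≠ 0) :
    ∫ u in Set.Ioi (1 / 2 : ℝ), Real.exp (u * y) * (E (b * u) / u)
      = 2 / y * (E (1 / 2 * (b - y)) - Real.exp (y / 2) * E (1 / 2 * b)) := by
  have hderiv : ∀ u ∈ Set.Ici (1 / 2 : ℝ),
      HasDerivAt (fun v => Real.exp (v * y) * (E (b * v) / v))
        (y * (Real.exp (u * y) * (E (b * u) / u)) - Real.exp (-(u * (b - y))) / u ^ 2) u := by
    intro u hu
    have hu' : 1 / 2 ≤ u := hu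
    have h := (((hasDerivAt_id u).mul_const y).exp).mul
      (hasDerivAt_E_mul_div hb (by linarith : 0 < u))
    refine h.congr_deriv ?_
    have : -(u * (b - y)) = u * y + -(u * b) := by ring
    rw [this, Real.exp_add]
    simp only [id]
    ring
  have hi1 := integrableOn_exp_mul_E_mul_div hb hyb
  have hi2 := integrableOn_exp_neg_mul_div_sq (sub_pos.2 hyb).le (by norm_num : (0 : ℝ) < 1 / 2)
  have hlim : Tendsto (fun v => Real.exp (v * y) * (E (b * v) / v)) atTop (𝓝 0) := by
    refine squeeze_zero' (g := fun v => v⁻¹) ?_ ?_ tendsto_inv_atTop_zero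
    · filter_upwards [eventually_gt_atTop 0] with v hv
      exact mul_nonneg (Real.exp_pos _).le (div_nonneg (E_nonneg _) hv.le)
    · filter_upwards [eventually_gt_atTop 0] with v hv
      rw [← mul_div_assoc, div_eq_mul_inv]
      refine mul_le_of_le_one_left (by positivity) ?_
      calc Real.exp (v * y) * E (b * v) ≤ Real.exp (v * y) * Real.exp (-(b * v)) := by
            gcongr
            exact E_le_exp_neg (by positivity)
        _ ≤ 1 := by
            rw [← Real.exp_add, Real.exp_le_one_iff]
            nlinarith
  have h := integral_Ioi_of_hasDerivAt_of_tendsto' hderiv ((hi1.const_mul y).sub hi2) hlim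
  rw [integral_sub (hi1.const_mul y) hi2, integral_const_mul,
    integral_Ioi_half_exp_neg_mul_div_sq] at h
  have e1 : (1 / 2 : ℝ) * y = y / 2 := by ring
  have e2 : b * (1 / 2 : ℝ) = 1 / 2 * b := by ring
  rw [e1, e2] at h
  rw [div_mul_eq_mul_div, eq_div_iff hy]
  linarith

theorem exp_mul_F_eq {a u x : ℝ} (ha : 0 < a) (hu : 0 < u) :
    Real.exp (u * x) * F a u = 1 / c * (Real.exp (-(u * (2 / a - x))) / u ^ 2
      + Real.exp (u * (x - 1)) * (E ((2 / a - 1) * u) / u)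
      - Real.exp (u * (x + 1)) * (E ((2 / a + 1) * u) / u)) := by
  have e1 : (2 - a) / a = 2 / a - 1 := by field_simp
  have e2 : (2 + a) / a = 2 / a + 1 := by field_simp
  have e3 : -(u * (2 / a - x)) = u * x + -2 * u / a := by ring
  have e4 : u * (x - 1) = u * x + -u := by ring
  have e5 : u * (x + 1) = u * x + u := by ring
  rw [F, e1, e2, e3, e4, e5, Real.exp_add, Real.exp_add, Real.exp_add, one_div, mul_inv]
  field_simp

theorem two_le_two_div {a : ℝ} (ha : 0 < a) (ha1 : a ≤ 1) : 2 ≤ 2 / a := by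
  rw [le_div_iff₀ ha]
  linarith

theorem integrableOn_exp_mul_F {a x : ℝ} (ha : 0 < a) (ha1 : a ≤ 1) (hx : x ∈ Set.Ioo (-1 : ℝ) 1) :
    IntegrableOn (fun u => Real.exp (u * x) * F a u) (Set.Ioi (1 / 2)) := by
  have h2 := two_le_two_div ha ha1
  obtain ⟨hx1, hx2⟩ := hx
  have hA := integrableOn_exp_neg_mul_div_sq (by linarith : 0 ≤ 2 / a - x)
    (by norm_num : (0 : ℝ) < 1 / 2)
  have hB := integrableOn_exp_mul_E_mul_div (by linarith : 0 ≤ 2 / a - 1)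
    (by linarith : x - 1 < 2 / a - 1)
  have hC := integrableOn_exp_mul_E_mul_div (by linarith : 0 ≤ 2 / a + 1)
    (by linarith : x + 1 < 2 / a + 1)
  refine IntegrableOn.congr_fun (((hA.add hB).sub hC).const_mul (1 / c)) (fun u hu => ?_)
    measurableSet_Ioi
  exact (exp_mul_F_eq ha (lt_trans (by norm_num) hu)).symm

theorem integral_exp_mul_F {a x : ℝ} (ha : 0 < a) (ha1 : a ≤ 1) (hx : x ∈ Set.Ioo (-1 : ℝ) 1) :
    ∫ u in Set.Ioi (1 / 2 : ℝ), Real.exp (u * x) * F a u = K a x := by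
  have h2 := two_le_two_div ha ha1
  obtain ⟨hx1, hx2⟩ := hx
  have hA := integrableOn_exp_neg_mul_div_sq (by linarith : 0 ≤ 2 / a - x)
    (by norm_num : (0 : ℝ) < 1 / 2)
  have hB := integrableOn_exp_mul_E_mul_div (by linarith : 0 ≤ 2 / a - 1)
    (by linarith : x - 1 < 2 / a - 1)
  have hC := integrableOn_exp_mul_E_mul_div (by linarith : 0 ≤ 2 / a + 1)
    (by linarith : x + 1 < 2 / a + 1)
  rw [setIntegral_congr_fun measurableSet_Ioi fun u hu =>
      exp_mul_F_eq (x := x) ha (lt_trans (by norm_num) hu), integral_const_mul,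
    integral_sub (by exact hA.add hB) hC, integral_add hA hB, integral_Ioi_half_exp_neg_mul_div_sq,
    integral_exp_mul_E_mul_div (by linarith) (by linarith) (by linarith),
    integral_exp_mul_E_mul_div (by linarith) (by linarith) (by linarith), K]
  have e1 : 2 / a - 1 - (x - 1) = 2 / a - x := by ring
  have e2 : 2 / a + 1 - (x + 1) = 2 / a - x := by ring
  rw [e1, e2]
  ring

theorem abs_F_le {a u : ℝ} (ha : 0 < a) (ha1 : a ≤ 1) (hu : 1 / 2 < u) :
    |F a u| ≤ 8 * |1 / c| * Real.exp (-2 * u) := by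
  have h2 := two_le_two_div ha ha1
  have hu0 : 0 < u := by linarith
  have h := exp_mul_F_eq (x := 0) ha hu0
  rw [mul_zero, Real.exp_zero, one_mul] at h
  have hE : ∀ b ≥ 0, ∀ y, 2 ≤ b - y → 0 ≤ Real.exp (u * y) * (E (b * u) / u) ∧
      Real.exp (u * y) * (E (b * u) / u) ≤ 2 * Real.exp (-2 * u) := by
    intro b hb y hby
    refine ⟨mul_nonneg (Real.exp_pos _).le (div_nonneg (E_nonneg _) hu0.le), ?_⟩
    rw [← mul_div_assoc, div_le_iff₀ hu0]
    calc Real.exp (u * y) * E (b * u) ≤ Real.exp (u * y) * Real.exp (-(b * u)) := by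
          gcongr
          exact E_le_exp_neg (by positivity)
      _ ≤ Real.exp (-2 * u) := by
          rw [← Real.exp_add, Real.exp_le_exp]
          nlinarith
      _ ≤ 2 * Real.exp (-2 * u) * u := by nlinarith [Real.exp_pos (-2 * u)]
  have hA : Real.exp (-(u * (2 / a - 0))) / u ^ 2 ≤ 4 * Real.exp (-2 * u) := by
    rw [div_le_iff₀ (by positivity)]
    calc Real.exp (-(u * (2 / a - 0))) ≤ Real.exp (-2 * u) := by
          rw [Real.exp_le_exp]
          nlinarith
      _ ≤ 4 * Real.exp (-2 * u) * u ^ 2 := by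
          nlinarith [Real.exp_pos (-2 * u), mul_pos (Real.exp_pos (-2 * u)) (by nlinarith : 0 < 4 * u ^ 2 - 1)]
  have hA0 : 0 ≤ Real.exp (-(u * (2 / a - 0))) / u ^ 2 := by positivity
  obtain ⟨hB0, hB⟩ := hE (2 / a - 1) (by linarith) (0 - 1) (by linarith)
  obtain ⟨hC0, hC⟩ := hE (2 / a + 1) (by linarith) (0 + 1) (by linarith)
  rw [h, abs_mul, mul_comm 8, mul_assoc]
  gcongr
  rw [abs_le]
  constructor <;> linarith [Real.exp_pos (-2 * u)]

theorem laplaceDeriv_eq_setIntegral {ψ : ℝ → ℝ}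
    (hsupp : ∀ x : ℝ, x ∉ Set.Icc (-1 : ℝ) 1 → ψ x = 0) (u : ℝ) :
    laplaceDeriv ψ u = ∫ x in Set.Ioo (-1 : ℝ) 1, x * ψ x * Real.exp (u * x) := by
  rw [laplaceDeriv, ← integral_Icc_eq_integral_Ioo,
    setIntegral_eq_integral_of_forall_compl_eq_zero]
  intro x hx
  simp [hsupp x hx]

theorem integrable_F_sub_mul_prod {a : ℝ} (ha0 : 0 < a) (ha1 : a ≤ 1) {ψ : ℝ → ℝ}
    (hint : Integrable ψ) :
    Integrable (fun z : ℝ × ℝ =>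
        (F 1 z.1 - F a z.1) * (z.2 * ψ z.2 * Real.exp ((z.1 + 1 / 2) * z.2)))
      ((volume.restrict (Set.Ioi (1 / 2))).prod (volume.restrict (Set.Ioo (-1) 1))) := by
  have hF1 := measurable_F 1
  have hFa := measurable_F a
  have hψ : AEStronglyMeasurable (fun z : ℝ × ℝ => ψ z.2)
      ((volume.restrict (Set.Ioi (1 / 2))).prod (volume.restrict (Set.Ioo (-1) 1))) :=
    hint.aestronglyMeasurable.restrict.comp_snd
  have hdom : Integrable
      (fun z : ℝ × ℝ => 16 * |1 / c| * Real.exp (1 / 2) * Real.exp (-1 * z.1) * |ψ z.2|)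
      ((volume.restrict (Set.Ioi (1 / 2))).prod (volume.restrict (Set.Ioo (-1) 1))) :=
    ((exp_neg_integrableOn_Ioi (1 / 2) one_pos).const_mul _).mul_prod hint.abs.restrict
  refine hdom.mono' ?_ ?_
  · refine AEStronglyMeasurable.mul (Measurable.aestronglyMeasurable (by fun_prop)) ?_
    refine AEStronglyMeasurable.mul (AEStronglyMeasurable.mul ?_ hψ) ?_ <;>
      exact Measurable.aestronglyMeasurable (by fun_prop)
  · rw [Measure.prod_restrict]
    filter_upwards [ae_restrict_mem (measurableSet_Ioi.prod measurableSet_Ioo)] with z hz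
    obtain ⟨hu, hx1, hx2⟩ := hz
    have hu' : 1 / 2 < z.1 := hu
    have hF : |F 1 z.1 - F a z.1| ≤ 16 * |1 / c| * Real.exp (-2 * z.1) := by
      have := abs_F_le one_pos le_rfl hu'
      have := abs_F_le ha0 ha1 hu'
      have := abs_sub (F 1 z.1) (F a z.1)
      linarith
    have hx : |z.2| ≤ 1 := abs_le.2 ⟨hx1.le, hx2.le⟩
    have hexp : Real.exp ((z.1 + 1 / 2) * z.2) ≤ Real.exp (z.1 + 1 / 2) :=
      Real.exp_le_exp.2 (by nlinarith)
    rw [Real.norm_eq_abs, abs_mul, abs_mul, abs_mul, abs_of_pos (Real.exp_pos _)]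
    calc |F 1 z.1 - F a z.1| * (|z.2| * |ψ z.2| * Real.exp ((z.1 + 1 / 2) * z.2))
        ≤ 16 * |1 / c| * Real.exp (-2 * z.1) * (1 * |ψ z.2| * Real.exp (z.1 + 1 / 2)) := by
          gcongr
      _ = 16 * |1 / c| * Real.exp (1 / 2) * Real.exp (-1 * z.1) * |ψ z.2| := by
          have : -1 * z.1 = -2 * z.1 + z.1 := by ring
          rw [this, Real.exp_add, Real.exp_add]
          ring

theorem stmt3 (a : ℝ) (ha0 : 0 < a) (ha1 : a < 1)
    (ψ : ℝ → ℝ) (hint : Integrable ψ)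
    (hsupp : ∀ x : ℝ, x ∉ Set.Icc (-1:ℝ) 1 → ψ x = 0) :
    IntegrableOn (fun u => (F 1 u - F a u) * laplaceDeriv ψ (u + 1/2)) (Set.Ioi (1/2 : ℝ)) ∧
    IntegrableOn (fun x => x * ψ x * Real.exp (x/2) * (K 1 x - K a x)) (Set.Ioo (-1:ℝ) 1) ∧
    ∫ u in Set.Ioi (1/2 : ℝ), (F 1 u - F a u) * laplaceDeriv ψ (u + 1/2)
      = ∫ x in Set.Ioo (-1:ℝ) 1, x * ψ x * Real.exp (x/2) * (K 1 x - K a x) := by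
  have hprod := integrable_F_sub_mul_prod ha0 ha1.le hint
  have hleft : (fun u => (F 1 u - F a u) * laplaceDeriv ψ (u + 1 / 2)) = fun u =>
      ∫ x in Set.Ioo (-1 : ℝ) 1, (F 1 u - F a u) * (x * ψ x * Real.exp ((u + 1 / 2) * x)) := by
    funext u
    rw [laplaceDeriv_eq_setIntegral hsupp, integral_const_mul]
  have hright : ∀ x ∈ Set.Ioo (-1 : ℝ) 1, ∫ u in Set.Ioi (1 / 2 : ℝ),
      (F 1 u - F a u) * (x * ψ x * Real.exp ((u + 1 / 2) * x))
        = x * ψ x * Real.exp (x / 2) * (K 1 x - K a x) := by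
    intro x hx
    rw [← integral_exp_mul_F one_pos le_rfl hx, ← integral_exp_mul_F ha0 ha1.le hx,
      ← integral_sub (integrableOn_exp_mul_F one_pos le_rfl hx)
        (integrableOn_exp_mul_F ha0 ha1.le hx), ← integral_const_mul]
    congr 1 with u
    have : (u + 1 / 2) * x = u * x + x / 2 := by ring
    rw [this, Real.exp_add]
    ring
  refine ⟨?_, ?_, ?_⟩
  · rw [hleft]
    exact hprod.integral_prod_left
  · exact IntegrableOn.congr_fun hprod.integral_prod_right hright measurableSet_Ioo
  · rw [hleft, integral_integral_swap hprod]
    exact setIntegral_congr_fun measurableSet_Ioo hright
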